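/- arXiv:2509.26052 — 4 statements merged into one kernel-verified Lean document; each statement's English description precedes it below -/
import Mathlib

section
/- Let p be an odd prime. The number of ZMod p²-submodules L of (ZMod p²)⁴ that are Lagrangian with respect to the bilinear form b(x,y) = x₁y₁ + x₂y₂ − x₃y₃ − x₄y₄ equals 3p² + 4p + 2. -/
/-- The polarization of the determinant on `2 × 2` matrices. -/
def polarDet {R : Type*} [CommRing R] (M N : Matrix (Fin 2) (Fin 2) R) : R :=
  M 0 0 * N 1 1 + M 1 1 * N 0 0 - M 0 1 * N 1 0 - M 1 0 * N 0 1

/-- A submodule of matrices that equals its orthogonal complement for `polarDet`. -/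
def IsDetLagrangian {R : Type*} [CommRing R]
    (L : Submodule R (Matrix (Fin 2) (Fin 2) R)) : Prop :=
  ∀ M, M ∈ L ↔ ∀ N ∈ L, polarDet M N = 0

/-- The matrices all of whose columns are proportional to `u`. -/
def colSubmodule {R : Type*} [CommRing R] (u : R × R) :
    Submodule R (Matrix (Fin 2) (Fin 2) R) where
  carrier := {M | ∀ j, u.1 * M 1 j = u.2 * M 0 j}
  add_mem' {M N} hM hN j := by
    simp only [Matrix.add_apply]
    linear_combination hM j + hN j
  zero_mem' j := by simp
  smul_mem' c M hM j := by
    simp only [Matrix.smul_apply, smul_eq_mul]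
    linear_combination c * hM j

/-- The matrices all of whose rows are proportional to `w`. -/
def rowSubmodule {R : Type*} [CommRing R] (w : R × R) :
    Submodule R (Matrix (Fin 2) (Fin 2) R) where
  carrier := {M | ∀ i, w.1 * M i 1 = w.2 * M i 0}
  add_mem' {M N} hM hN i := by
    simp only [Matrix.add_apply]
    linear_combination hM i + hN i
  zero_mem' i := by simp
  smul_mem' c M hM i := by
    simp only [Matrix.smul_apply, smul_eq_mul]
    linear_combination c * hM i

/-- The matrices orthogonal to `u ⊗ w` that are proportional to `u ⊗ w` modulo the annihilator
of `π`. -/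
def mixedSubmodule {R : Type*} [CommRing R] (π : R) (u w : R × R) :
    Submodule R (Matrix (Fin 2) (Fin 2) R) where
  carrier := {M | (∀ j, π * (u.1 * M 1 j - u.2 * M 0 j) = 0) ∧
    (∀ i, π * (w.1 * M i 1 - w.2 * M i 0) = 0) ∧
    w.1 * (u.1 * M 1 1 - u.2 * M 0 1) - w.2 * (u.1 * M 1 0 - u.2 * M 0 0) = 0}
  add_mem' {M N} hM hN := by
    simp only [Set.mem_ofPred_eq, Matrix.add_apply]
    refine ⟨fun j => ?_, fun i => ?_, ?_⟩
    · linear_combination hM.1 j + hN.1 j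
    · linear_combination hM.2.1 i + hN.2.1 i
    · linear_combination hM.2.2 + hN.2.2
  zero_mem' := by simp
  smul_mem' c M hM := by
    simp only [Set.mem_ofPred_eq, Matrix.smul_apply, smul_eq_mul]
    refine ⟨fun j => ?_, fun i => ?_, ?_⟩
    · linear_combination c * hM.1 j
    · linear_combination c * hM.2.1 i
    · linear_combination c * hM.2.2

/-- The matrices killed by `π`. -/
def torsionSubmodule {R : Type*} [CommRing R] (π : R) :
    Submodule R (Matrix (Fin 2) (Fin 2) R) where
  carrier := {M | ∀ i j, π * M i j = 0}
  add_mem' {M N} hM hN i j := by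
    simp only [Matrix.add_apply]
    linear_combination hM i j + hN i j
  zero_mem' i j := by simp
  smul_mem' c M hM i j := by
    simp only [Matrix.smul_apply, smul_eq_mul]
    linear_combination c * hM i j

section Membership

variable {R : Type*} [CommRing R] {π : R} {u w : R × R} {M : Matrix (Fin 2) (Fin 2) R}

theorem mem_colSubmodule : M ∈ colSubmodule u ↔ ∀ j, u.1 * M 1 j = u.2 * M 0 j := Iff.rfl

theorem mem_rowSubmodule : M ∈ rowSubmodule w ↔ ∀ i, w.1 * M i 1 = w.2 * M i 0 := Iff.rfl

theorem mem_mixedSubmodule : M ∈ mixedSubmodule π u w ↔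
    (∀ j, π * (u.1 * M 1 j - u.2 * M 0 j) = 0) ∧
    (∀ i, π * (w.1 * M i 1 - w.2 * M i 0) = 0) ∧
    w.1 * (u.1 * M 1 1 - u.2 * M 0 1) - w.2 * (u.1 * M 1 0 - u.2 * M 0 0) = 0 := Iff.rfl

theorem mem_torsionSubmodule : M ∈ torsionSubmodule π ↔ ∀ i j, π * M i j = 0 := Iff.rfl

end Membership

/-- `π` generates the maximal ideal of a local ring of length two. -/
structure IsSquareZeroUniformizer {R : Type*} [CommRing R] (π : R) : Prop where
  ne_zero : π ≠ 0
  mul_self : π * π = 0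
  isUnit_or (x : R) : IsUnit x ∨ ∃ y, x = π * y

/-- Expansion of `polarDet` in bases of `R²` that extend `u` and `w`. -/
theorem polarDet_eq_of_bezout {R : Type*} [CommRing R] {u w : R × R} {a b c d : R}
    (hu : a * u.1 + b * u.2 = 1) (hw : c * w.1 + d * w.2 = 1)
    (M N : Matrix (Fin 2) (Fin 2) R) :
    polarDet M N =
      (a * (c * M 0 0 + d * M 0 1) + b * (c * M 1 0 + d * M 1 1)) *
        (w.1 * (u.1 * N 1 1 - u.2 * N 0 1) - w.2 * (u.1 * N 1 0 - u.2 * N 0 0)) +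
      (w.1 * (u.1 * M 1 1 - u.2 * M 0 1) - w.2 * (u.1 * M 1 0 - u.2 * M 0 0)) *
        (a * (c * N 0 0 + d * N 0 1) + b * (c * N 1 0 + d * N 1 1)) -
      (c * (u.1 * M 1 0 - u.2 * M 0 0) + d * (u.1 * M 1 1 - u.2 * M 0 1)) *
        (a * (w.1 * N 0 1 - w.2 * N 0 0) + b * (w.1 * N 1 1 - w.2 * N 1 0)) -
      (a * (w.1 * M 0 1 - w.2 * M 0 0) + b * (w.1 * M 1 1 - w.2 * M 1 0)) *
        (c * (u.1 * N 1 0 - u.2 * N 0 0) + d * (u.1 * N 1 1 - u.2 * N 0 1)) := by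
  have key : polarDet M N = (a * u.1 + b * u.2) * (c * w.1 + d * w.2) * polarDet M N := by
    rw [hu, hw]; ring
  rw [key]
  simp only [polarDet]
  ring

/-- The tensor `u ⊗ w` as a matrix. -/
def tensorMatrix {R : Type*} [CommRing R] (u w : R × R) : Matrix (Fin 2) (Fin 2) R :=
  !![u.1 * w.1, u.1 * w.2; u.2 * w.1, u.2 * w.2]

theorem tensorMatrix_mem_colSubmodule {R : Type*} [CommRing R] (u w : R × R) :
    tensorMatrix u w ∈ colSubmodule u := by
  intro j
  fin_cases j <;> simp [tensorMatrix] <;> ring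

theorem tensorMatrix_mem_rowSubmodule {R : Type*} [CommRing R] (u w : R × R) :
    tensorMatrix u w ∈ rowSubmodule w := by
  intro j
  fin_cases j <;> simp [tensorMatrix] <;> ring

theorem tensorMatrix_mem_mixedSubmodule {R : Type*} [CommRing R] (π : R) (u w : R × R) :
    tensorMatrix u w ∈ mixedSubmodule π u w := by
  simp only [mem_mixedSubmodule, Fin.forall_fin_two]
  simp only [tensorMatrix, Matrix.of_apply, Matrix.cons_val', Matrix.cons_val_zero,
    Matrix.cons_val_one, Matrix.cons_val_fin_one]
  refine ⟨⟨?_, ?_⟩, ⟨?_, ?_⟩, ?_⟩ <;> ring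

/-- A Lagrangian contained in another one is equal to it. -/
theorem IsDetLagrangian.eq_of_le {R : Type*} [CommRing R]
    {L K : Submodule R (Matrix (Fin 2) (Fin 2) R)} (hL : IsDetLagrangian L)
    (hK : IsDetLagrangian K) (hle : L ≤ K) : L = K :=
  le_antisymm hle fun M hM => (hL M).2 fun N hN => (hK M).1 hM N (hle hN)

theorem isDetLagrangian_colSubmodule {R : Type*} [CommRing R] {u : R × R}
    (hu : IsCoprime u.1 u.2) : IsDetLagrangian (colSubmodule u) := by
  obtain ⟨a, b, hab⟩ := hu
  refine fun M => ⟨fun hM N hN => ?_, fun hM => ?_⟩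
  · have hM0 := hM 0
    have hM1 := hM 1
    have hN0 := hN 0
    have hN1 := hN 1
    rw [polarDet_eq_of_bezout (w := (1, 0)) (c := 1) (d := 0) hab (by simp)]
    grind
  · have h0 := hM _ (tensorMatrix_mem_colSubmodule u (1, 0))
    have h1 := hM _ (tensorMatrix_mem_colSubmodule u (0, 1))
    simp [polarDet, tensorMatrix] at h0 h1
    rw [mem_colSubmodule, Fin.forall_fin_two]
    constructor <;> grind

theorem isDetLagrangian_rowSubmodule {R : Type*} [CommRing R] {w : R × R}
    (hw : IsCoprime w.1 w.2) : IsDetLagrangian (rowSubmodule w) := by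
  obtain ⟨c, d, hcd⟩ := hw
  refine fun M => ⟨fun hM N hN => ?_, fun hM => ?_⟩
  · have hM0 := hM 0
    have hM1 := hM 1
    have hN0 := hN 0
    have hN1 := hN 1
    rw [polarDet_eq_of_bezout (u := (1, 0)) (a := 1) (b := 0) (by simp) hcd]
    grind
  · have h0 := hM _ (tensorMatrix_mem_rowSubmodule (1, 0) w)
    have h1 := hM _ (tensorMatrix_mem_rowSubmodule (0, 1) w)
    simp [polarDet, tensorMatrix] at h0 h1
    rw [mem_rowSubmodule, Fin.forall_fin_two]
    constructor <;> grind

theorem colSubmodule_le_of_cross {R : Type*} [CommRing R] {u u' : R × R}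
    (hu : IsCoprime u.1 u.2) (huu : u.1 * u'.2 = u.2 * u'.1) :
    colSubmodule u ≤ colSubmodule u' := by
  obtain ⟨a, b, hab⟩ := hu
  intro M hM j
  have hj := hM j
  linear_combination (u'.2 * M 0 j - u'.1 * M 1 j) * hab + (a * u'.1 + b * u'.2) * hj +
    (-a * M 0 j - b * M 1 j) * huu

theorem rowSubmodule_le_of_cross {R : Type*} [CommRing R] {w w' : R × R}
    (hw : IsCoprime w.1 w.2) (hww : w.1 * w'.2 = w.2 * w'.1) :
    rowSubmodule w ≤ rowSubmodule w' := by
  obtain ⟨a, b, hab⟩ := hw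
  intro M hM i
  have hi := hM i
  linear_combination (w'.2 * M i 0 - w'.1 * M i 1) * hab + (a * w'.1 + b * w'.2) * hi +
    (-a * M i 0 - b * M i 1) * hww

theorem cross_of_colSubmodule_eq {R : Type*} [CommRing R] {u u' : R × R}
    (heq : colSubmodule u = colSubmodule u') : u'.1 * u.2 = u'.2 * u.1 := by
  have h0 := mem_colSubmodule.1 (heq ▸ tensorMatrix_mem_colSubmodule u (1, 0)) 0
  simpa [tensorMatrix] using h0

theorem cross_of_rowSubmodule_eq {R : Type*} [CommRing R] {w w' : R × R}
    (heq : rowSubmodule w = rowSubmodule w') : w'.1 * w.2 = w'.2 * w.1 := by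
  have h0 := mem_rowSubmodule.1 (heq ▸ tensorMatrix_mem_rowSubmodule (1, 0) w) 0
  simpa [tensorMatrix] using h0

theorem cross_of_mixedSubmodule_eq {R : Type*} [CommRing R] {π : R} {u u' w w' : R × R}
    (hu : IsCoprime u.1 u.2) (hw : IsCoprime w.1 w.2)
    (heq : mixedSubmodule π u w = mixedSubmodule π u' w') :
    π * (u'.1 * u.2 - u'.2 * u.1) = 0 ∧ π * (w'.1 * w.2 - w'.2 * w.1) = 0 := by
  obtain ⟨a, b, hab⟩ := hu
  obtain ⟨c, d, hcd⟩ := hw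
  have h0 := mem_mixedSubmodule.1 (heq ▸ tensorMatrix_mem_mixedSubmodule π u w)
  simp only [tensorMatrix, Fin.forall_fin_two, Matrix.of_apply, Matrix.cons_val',
    Matrix.cons_val_zero, Matrix.cons_val_one, Matrix.cons_val_fin_one] at h0
  obtain ⟨⟨hc, hd⟩, ⟨ha, hb⟩, -⟩ := h0
  constructor
  · linear_combination c * hc + d * hd - π * (u'.1 * u.2 - u'.2 * u.1) * hcd
  · linear_combination a * ha + b * hb - π * (w'.1 * w.2 - w'.2 * w.1) * hab

namespace IsSquareZeroUniformizer

variable {R : Type*} [CommRing R] {π : R}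

theorem exists_eq_mul (h : IsSquareZeroUniformizer π) {x : R} (hx : π * x = 0) :
    ∃ y, x = π * y :=
  (h.isUnit_or x).resolve_left fun hu => h.ne_zero (hu.mul_left_eq_zero.1 hx)

theorem isUnit_of_mul_ne_zero (h : IsSquareZeroUniformizer π) {x : R} (hx : π * x ≠ 0) :
    IsUnit x := by
  refine (h.isUnit_or x).resolve_right ?_
  rintro ⟨y, rfl⟩
  exact hx (by rw [← mul_assoc, h.mul_self, zero_mul])

theorem mul_eq_zero_of (h : IsSquareZeroUniformizer π) {x y : R} (hx : π * x = 0)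
    (hy : π * y = 0) : x * y = 0 := by
  obtain ⟨x, rfl⟩ := h.exists_eq_mul hx
  linear_combination x * hy

theorem isDetLagrangian_torsionSubmodule (h : IsSquareZeroUniformizer π) :
    IsDetLagrangian (torsionSubmodule π) := by
  refine fun M => ⟨fun hM N hN => ?_, fun hM => ?_⟩
  · simp only [polarDet, h.mul_eq_zero_of (hM _ _) (hN _ _)]
    ring
  · have hmem (u w : R × R) : π • tensorMatrix u w ∈ torsionSubmodule π := by
      intro i j
      rw [Matrix.smul_apply, smul_eq_mul, ← mul_assoc, h.mul_self, zero_mul]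
    have h00 := hM _ (hmem (1, 0) (1, 0))
    have h01 := hM _ (hmem (1, 0) (0, 1))
    have h10 := hM _ (hmem (0, 1) (1, 0))
    have h11 := hM _ (hmem (0, 1) (0, 1))
    simp [polarDet, tensorMatrix] at h00 h01 h10 h11
    simp only [mem_torsionSubmodule, Fin.forall_fin_two]
    grind

theorem isDetLagrangian_mixedSubmodule (h : IsSquareZeroUniformizer π) {u w : R × R}
    (hu : IsCoprime u.1 u.2) (hw : IsCoprime w.1 w.2) :
    IsDetLagrangian (mixedSubmodule π u w) := by
  refine fun M => ⟨fun hM N hN => ?_, fun hM => ?_⟩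
  · obtain ⟨a, b, hab⟩ := hu
    obtain ⟨c, d, hcd⟩ := hw
    rw [polarDet_eq_of_bezout hab hcd, hM.2.2, hN.2.2]
    have hα (K) (hK : K ∈ mixedSubmodule π u w) :
        π * (c * (u.1 * K 1 0 - u.2 * K 0 0) + d * (u.1 * K 1 1 - u.2 * K 0 1)) = 0 := by
      linear_combination c * hK.1 0 + d * hK.1 1
    have hβ (K) (hK : K ∈ mixedSubmodule π u w) :
        π * (a * (w.1 * K 0 1 - w.2 * K 0 0) + b * (w.1 * K 1 1 - w.2 * K 1 0)) = 0 := by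
      linear_combination a * hK.2.1 0 + b * hK.2.1 1
    rw [h.mul_eq_zero_of (hα M hM) (hβ N hN), h.mul_eq_zero_of (hβ M hM) (hα N hN)]
    ring
  · have hcol (v : R × R) : π • tensorMatrix u v ∈ mixedSubmodule π u w := by
      have := h.mul_self
      simp only [mem_mixedSubmodule, Fin.forall_fin_two]
      simp [tensorMatrix]
      grind
    have hrow (v : R × R) : π • tensorMatrix v w ∈ mixedSubmodule π u w := by
      have := h.mul_self
      simp only [mem_mixedSubmodule, Fin.forall_fin_two]
      simp [tensorMatrix]
      grind
    have h0 := hM _ (tensorMatrix_mem_mixedSubmodule π u w)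
    have hc0 := hM _ (hcol (1, 0))
    have hc1 := hM _ (hcol (0, 1))
    have hr0 := hM _ (hrow (1, 0))
    have hr1 := hM _ (hrow (0, 1))
    simp [polarDet, tensorMatrix] at h0 hc0 hc1 hr0 hr1
    simp only [mem_mixedSubmodule, Fin.forall_fin_two]
    refine ⟨⟨?_, ?_⟩, ⟨?_, ?_⟩, ?_⟩
    · linear_combination -hc1
    · linear_combination hc0
    · linear_combination -hr1
    · linear_combination hr0
    · linear_combination h0

/-- A singular matrix with a unit entry is a tensor of unimodular vectors. -/
theorem exists_eq_tensorMatrix (h : IsSquareZeroUniformizer π) {M : Matrix (Fin 2) (Fin 2) R}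
    (hdet : M 0 0 * M 1 1 = M 0 1 * M 1 0) (hM : M ∉ torsionSubmodule π) :
    ∃ u w : R × R, IsCoprime u.1 u.2 ∧ IsCoprime w.1 w.2 ∧ M = tensorMatrix u w := by
  rw [mem_torsionSubmodule] at hM
  push Not at hM
  obtain ⟨i, j, hij⟩ := hM
  obtain ⟨e, he⟩ := (h.isUnit_of_mul_ne_zero hij).exists_left_inv
  refine ⟨(M 0 j, M 1 j), (e * M i 0, e * M i 1), ?_, ?_, ?_⟩
  · fin_cases i
    · exact ⟨e, 0, by simpa using he⟩
    · exact ⟨0, e, by simpa using he⟩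
  · fin_cases j
    · exact ⟨1, 0, by simpa using he⟩
    · exact ⟨0, 1, by simpa using he⟩
  · ext k l
    fin_cases i <;> fin_cases j <;> fin_cases k <;> fin_cases l <;>
      simp [tensorMatrix] at he ⊢ <;> grind

/-- The classification of the Lagrangians for `polarDet`. -/
theorem classification (h : IsSquareZeroUniformizer π) (h2 : IsUnit (2 : R))
    {L : Submodule R (Matrix (Fin 2) (Fin 2) R)} (hL : IsDetLagrangian L) :
    L = torsionSubmodule π ∨ ∃ u w : R × R, IsCoprime u.1 u.2 ∧ IsCoprime w.1 w.2 ∧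
      (L = colSubmodule u ∨ L = rowSubmodule w ∨ L = mixedSubmodule π u w) := by
  by_cases hT : L ≤ torsionSubmodule π
  · exact Or.inl (hL.eq_of_le h.isDetLagrangian_torsionSubmodule hT)
  right
  obtain ⟨T, hTL, hT⟩ := SetLike.not_le_iff_exists.1 hT
  obtain ⟨u, w, hu, hw, rfl⟩ := h.exists_eq_tensorMatrix
    (by
      have := (hL T).1 hTL T hTL
      simp only [polarDet] at this
      exact h2.mul_left_cancel (by linear_combination this)) hT
  refine ⟨u, w, hu, hw, ?_⟩
  have hperp (M) (hM : M ∈ L) :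
      w.1 * (u.1 * M 1 1 - u.2 * M 0 1) - w.2 * (u.1 * M 1 0 - u.2 * M 0 0) = 0 := by
    have := (hL M).1 hM _ hTL
    simp [polarDet, tensorMatrix] at this
    linear_combination this
  obtain ⟨a, b, hab⟩ := id hu
  obtain ⟨c, d, hcd⟩ := id hw
  let α (M : Matrix (Fin 2) (Fin 2) R) : R :=
    c * (u.1 * M 1 0 - u.2 * M 0 0) + d * (u.1 * M 1 1 - u.2 * M 0 1)
  let β (M : Matrix (Fin 2) (Fin 2) R) : R :=
    a * (w.1 * M 0 1 - w.2 * M 0 0) + b * (w.1 * M 1 1 - w.2 * M 1 0)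
  have hαβ (M) (hM : M ∈ L) (N) (hN : N ∈ L) : α M * β N + β M * α N = 0 := by
    have := (hL M).1 hM N hN
    rw [polarDet_eq_of_bezout hab hcd, hperp M hM, hperp N hN] at this
    simp only [α, β]
    linear_combination -this
  have hαβ_self (M) (hM : M ∈ L) : α M * β M = 0 :=
    h2.mul_left_cancel (by linear_combination hαβ M hM M hM)
  have hα0 (M) (hM : M ∈ L) : u.1 * M 1 0 - u.2 * M 0 0 = w.1 * α M := by
    simp only [α]
    linear_combination (-(u.1 * M 1 0 - u.2 * M 0 0)) * hcd - d * hperp M hM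
  have hα1 (M) (hM : M ∈ L) : u.1 * M 1 1 - u.2 * M 0 1 = w.2 * α M := by
    simp only [α]
    linear_combination (-(u.1 * M 1 1 - u.2 * M 0 1)) * hcd + c * hperp M hM
  have hβ0 (M) (hM : M ∈ L) : w.1 * M 0 1 - w.2 * M 0 0 = u.1 * β M := by
    simp only [β]
    linear_combination (-(w.1 * M 0 1 - w.2 * M 0 0)) * hab - b * hperp M hM
  have hβ1 (M) (hM : M ∈ L) : w.1 * M 1 1 - w.2 * M 1 0 = u.2 * β M := by
    simp only [β]
    linear_combination (-(w.1 * M 1 1 - w.2 * M 1 0)) * hab + a * hperp M hM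
  by_cases hA : ∃ M ∈ L, π * α M ≠ 0
  · obtain ⟨M, hM, hne⟩ := hA
    have hunit := h.isUnit_of_mul_ne_zero hne
    have hβM : β M = 0 := hunit.mul_right_eq_zero.1 (hαβ_self M hM)
    refine Or.inr (Or.inl (hL.eq_of_le (isDetLagrangian_rowSubmodule hw) fun N hN => ?_))
    have hβN : β N = 0 := hunit.mul_right_eq_zero.1 (by simpa [hβM] using hαβ M hM N hN)
    rw [mem_rowSubmodule, Fin.forall_fin_two]
    constructor
    · linear_combination hβ0 N hN + u.1 * hβN
    · linear_combination hβ1 N hN + u.2 * hβN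
  by_cases hB : ∃ M ∈ L, π * β M ≠ 0
  · obtain ⟨M, hM, hne⟩ := hB
    have hunit := h.isUnit_of_mul_ne_zero hne
    have hαM : α M = 0 := hunit.mul_left_eq_zero.1 (hαβ_self M hM)
    refine Or.inl (hL.eq_of_le (isDetLagrangian_colSubmodule hu) fun N hN => ?_)
    have hαN : α N = 0 := hunit.mul_right_eq_zero.1 (by simpa [hαM] using hαβ M hM N hN)
    rw [mem_colSubmodule, Fin.forall_fin_two]
    constructor
    · linear_combination hα0 N hN + w.1 * hαN
    · linear_combination hα1 N hN + w.2 * hαN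
  push Not at hA hB
  refine Or.inr (Or.inr (hL.eq_of_le (h.isDetLagrangian_mixedSubmodule hu hw) fun M hM => ?_))
  simp only [mem_mixedSubmodule, Fin.forall_fin_two]
  refine ⟨⟨?_, ?_⟩, ⟨?_, ?_⟩, hperp M hM⟩
  · linear_combination π * hα0 M hM + w.1 * hA M hM
  · linear_combination π * hα1 M hM + w.2 * hA M hM
  · linear_combination π * hβ0 M hM + u.1 * hB M hM
  · linear_combination π * hβ1 M hM + u.2 * hB M hM

theorem mixedSubmodule_le_of_cross (h : IsSquareZeroUniformizer π) {u u' w w' : R × R}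
    (hu : IsCoprime u.1 u.2) (hw : IsCoprime w.1 w.2)
    (huu : π * (u.1 * u'.2 - u.2 * u'.1) = 0) (hww : π * (w.1 * w'.2 - w.2 * w'.1) = 0) :
    mixedSubmodule π u w ≤ mixedSubmodule π u' w' := by
  have hcomb {v v' : R × R} (hv : IsCoprime v.1 v.2) (hvv : π * (v.1 * v'.2 - v.2 * v'.1) = 0) :
      ∃ s a b : R, v'.1 = s * v.1 + π * a ∧ v'.2 = s * v.2 + π * b := by
    obtain ⟨a, b, hab⟩ := hv
    obtain ⟨δ, hδ⟩ := h.exists_eq_mul hvv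
    refine ⟨a * v'.1 + b * v'.2, -b * δ, a * δ, ?_, ?_⟩
    · linear_combination (-v'.1) * hab - b * hδ
    · linear_combination (-v'.2) * hab + a * hδ
  obtain ⟨s, a, b, hs1, hs2⟩ := hcomb hu huu
  obtain ⟨r, c, d, hr1, hr2⟩ := hcomb hw hww
  have hπ := h.mul_self
  intro M hM
  obtain ⟨hα, hβ, hγ⟩ := mem_mixedSubmodule.1 hM
  rw [mem_mixedSubmodule, hs1, hs2, hr1, hr2]
  refine ⟨fun j => ?_, fun i => ?_, ?_⟩
  · linear_combination s * hα j + (a * M 1 j - b * M 0 j) * hπ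
  · linear_combination r * hβ i + (c * M i 1 - d * M i 0) * hπ
  · linear_combination r * s * hγ + r * (a * hβ 1 - b * hβ 0) + s * (c * hα 1 - d * hα 0) +
      (c * (a * M 1 1 - b * M 0 1) - d * (a * M 1 0 - b * M 0 0)) * hπ

theorem isUnit_or_isUnit (h : IsSquareZeroUniformizer π) {u : R × R}
    (hu : IsCoprime u.1 u.2) : IsUnit u.1 ∨ ((∃ y, u.1 = π * y) ∧ IsUnit u.2) := by
  obtain ⟨a, b, hab⟩ := hu
  refine (h.isUnit_or u.1).imp_right fun ⟨y, hy⟩ => ⟨⟨y, hy⟩, ?_⟩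
  refine (h.isUnit_or u.2).resolve_right fun ⟨z, hz⟩ => h.ne_zero ?_
  rw [hy, hz] at hab
  linear_combination (a * y + b * z) * h.mul_self - π * hab

theorem colSubmodule_ne_torsionSubmodule (h : IsSquareZeroUniformizer π) {u : R × R}
    (hu : IsCoprime u.1 u.2) : colSubmodule u ≠ torsionSubmodule π := by
  intro heq
  obtain ⟨a, b, hab⟩ := hu
  have h0 := mem_torsionSubmodule.1 (heq ▸ tensorMatrix_mem_colSubmodule u (1, 0))
  simp [tensorMatrix, Fin.forall_fin_two] at h0
  exact h.ne_zero (by linear_combination a * h0.1 + b * h0.2 - π * hab)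

theorem rowSubmodule_ne_torsionSubmodule (h : IsSquareZeroUniformizer π) {w : R × R}
    (hw : IsCoprime w.1 w.2) : rowSubmodule w ≠ torsionSubmodule π := by
  intro heq
  obtain ⟨c, d, hcd⟩ := hw
  have h0 := mem_torsionSubmodule.1 (heq ▸ tensorMatrix_mem_rowSubmodule (1, 0) w)
  simp [tensorMatrix, Fin.forall_fin_two] at h0
  exact h.ne_zero (by linear_combination c * h0.1 + d * h0.2 - π * hcd)

theorem mixedSubmodule_ne_torsionSubmodule (h : IsSquareZeroUniformizer π) {u w : R × R}
    (hu : IsCoprime u.1 u.2) (hw : IsCoprime w.1 w.2) :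
    mixedSubmodule π u w ≠ torsionSubmodule π := by
  intro heq
  obtain ⟨a, b, hab⟩ := hu
  obtain ⟨c, d, hcd⟩ := hw
  have h0 := mem_torsionSubmodule.1 (heq ▸ tensorMatrix_mem_mixedSubmodule π u w)
  simp [tensorMatrix, Fin.forall_fin_two] at h0
  refine h.ne_zero ?_
  linear_combination a * c * h0.1.1 + a * d * h0.1.2 + b * c * h0.2.1 + b * d * h0.2.2 -
    π * hab - π * (a * u.1 + b * u.2) * hcd

theorem colSubmodule_ne_rowSubmodule (h : IsSquareZeroUniformizer π) {u w : R × R}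
    (hu : IsCoprime u.1 u.2) (hw : IsCoprime w.1 w.2) : colSubmodule u ≠ rowSubmodule w := by
  intro heq
  obtain ⟨a, b, hab⟩ := hu
  obtain ⟨c, d, hcd⟩ := hw
  have h0 := mem_rowSubmodule.1 (heq ▸ tensorMatrix_mem_colSubmodule u (1, 0))
  have h1 := mem_rowSubmodule.1 (heq ▸ tensorMatrix_mem_colSubmodule u (0, 1))
  simp [tensorMatrix, Fin.forall_fin_two] at h0 h1
  refine h.ne_zero ?_
  linear_combination π * (-d * (a * h0.1 + b * h0.2) + c * (a * h1.1 + b * h1.2) - hab -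
    (a * u.1 + b * u.2) * hcd)

theorem colSubmodule_ne_mixedSubmodule (h : IsSquareZeroUniformizer π) {u v w : R × R}
    (hu : IsCoprime u.1 u.2) (hw : IsCoprime w.1 w.2) :
    colSubmodule u ≠ mixedSubmodule π v w := by
  intro heq
  obtain ⟨a, b, hab⟩ := hu
  obtain ⟨c, d, hcd⟩ := hw
  have h0 := (mem_mixedSubmodule.1 (heq ▸ tensorMatrix_mem_colSubmodule u (1, 0))).2.1
  have h1 := (mem_mixedSubmodule.1 (heq ▸ tensorMatrix_mem_colSubmodule u (0, 1))).2.1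
  simp [tensorMatrix, Fin.forall_fin_two] at h0 h1
  refine h.ne_zero ?_
  linear_combination d * (a * h0.1 + b * h0.2) + c * (a * h1.1 + b * h1.2) - π * hab -
    π * (a * u.1 + b * u.2) * hcd

theorem rowSubmodule_ne_mixedSubmodule (h : IsSquareZeroUniformizer π) {u v w : R × R}
    (hu : IsCoprime u.1 u.2) (hw : IsCoprime w.1 w.2) :
    rowSubmodule w ≠ mixedSubmodule π u v := by
  intro heq
  obtain ⟨a, b, hab⟩ := hu
  obtain ⟨c, d, hcd⟩ := hw
  have h0 := (mem_mixedSubmodule.1 (heq ▸ tensorMatrix_mem_rowSubmodule (1, 0) w)).1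
  have h1 := (mem_mixedSubmodule.1 (heq ▸ tensorMatrix_mem_rowSubmodule (0, 1) w)).1
  simp [tensorMatrix, Fin.forall_fin_two] at h0 h1
  refine h.ne_zero ?_
  linear_combination b * (c * h0.1 + d * h0.2) + a * (c * h1.1 + d * h1.2) - π * hab -
    π * (a * u.1 + b * u.2) * hcd

end IsSquareZeroUniformizer

/-- Representatives of the points of the projective line over `R`, when `digit` enumerates
representatives of the residue classes modulo `π`. -/
def liftPoint {R ι : Type*} [CommRing R] (π : R) (digit : ι → R) : R ⊕ ι → R × R :=
  Sum.elim (fun t => (1, t)) (fun k => (π * digit k, 1))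

/-- Representatives of the points of the projective line over the residue ring of `R`, when
`digit` enumerates representatives of the residue classes. -/
def residuePoint {R ι : Type*} [CommRing R] (digit : ι → R) : Option ι → R × R :=
  fun o => o.elim (0, 1) (fun k => (1, digit k))

section Points

variable {R ι : Type*} [CommRing R] {π : R} {digit : ι → R}

theorem isCoprime_liftPoint (x : R ⊕ ι) :
    IsCoprime (liftPoint π digit x).1 (liftPoint π digit x).2 := by
  cases x
  · exact isCoprime_one_left
  · exact isCoprime_one_right

theorem isCoprime_residuePoint (x : Option ι) :
    IsCoprime (residuePoint digit x).1 (residuePoint digit x).2 := by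
  cases x
  · exact isCoprime_one_right
  · exact isCoprime_one_left

theorem eq_of_liftPoint_cross (h : IsSquareZeroUniformizer π)
    (hinj : ∀ k l, π * digit k = π * digit l → k = l) {x y : R ⊕ ι}
    (hxy : (liftPoint π digit x).1 * (liftPoint π digit y).2 =
      (liftPoint π digit x).2 * (liftPoint π digit y).1) : x = y := by
  rcases x with s | k <;> rcases y with t | l <;> simp [liftPoint] at hxy
  · rw [hxy]
  · exact absurd (by linear_combination π * hxy + s * digit l * h.mul_self) h.ne_zero
  · exact absurd (by linear_combination -π * hxy + t * digit k * h.mul_self) h.ne_zero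
  · rw [hinj k l hxy]

theorem eq_of_residuePoint_cross (h : IsSquareZeroUniformizer π)
    (hinj : ∀ k l, π * digit k = π * digit l → k = l) {x y : Option ι}
    (hxy : π * ((residuePoint digit x).1 * (residuePoint digit y).2 -
      (residuePoint digit x).2 * (residuePoint digit y).1) = 0) : x = y := by
  rcases x with _ | k <;> rcases y with _ | l <;> simp [residuePoint] at hxy
  · rfl
  · exact absurd hxy h.ne_zero
  · exact absurd hxy h.ne_zero
  · rw [hinj k l (by linear_combination -hxy)]

theorem exists_liftPoint_cross (h : IsSquareZeroUniformizer π)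
    (hsurj : ∀ x, ∃ k y, x = digit k + π * y) {u : R × R} (hu : IsCoprime u.1 u.2) :
    ∃ x, u.1 * (liftPoint π digit x).2 = u.2 * (liftPoint π digit x).1 := by
  obtain hunit | ⟨⟨y, hy⟩, hunit⟩ := h.isUnit_or_isUnit hu
  · obtain ⟨e, he⟩ := hunit.exists_right_inv
    exact ⟨Sum.inl (e * u.2), by simp only [liftPoint, Sum.elim_inl]; linear_combination u.2 * he⟩
  · obtain ⟨e, he⟩ := hunit.exists_right_inv
    obtain ⟨k, z, hz⟩ := hsurj (e * y)
    refine ⟨Sum.inr k, ?_⟩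
    simp only [liftPoint, Sum.elim_inr]
    linear_combination hy + u.2 * π * hz - π * y * he + u.2 * z * h.mul_self

theorem exists_residuePoint_cross (h : IsSquareZeroUniformizer π)
    (hsurj : ∀ x, ∃ k y, x = digit k + π * y) {u : R × R} (hu : IsCoprime u.1 u.2) :
    ∃ x, π * (u.1 * (residuePoint digit x).2 - u.2 * (residuePoint digit x).1) = 0 := by
  obtain hunit | ⟨⟨y, hy⟩, -⟩ := h.isUnit_or_isUnit hu
  · obtain ⟨e, he⟩ := hunit.exists_right_inv
    obtain ⟨k, z, hz⟩ := hsurj (e * u.2)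
    refine ⟨some k, ?_⟩
    simp only [residuePoint, Option.elim_some]
    linear_combination -π * u.1 * hz + π * u.2 * he - u.1 * z * h.mul_self
  · refine ⟨none, ?_⟩
    simp only [residuePoint, Option.elim_none]
    linear_combination π * hy + y * h.mul_self

/-- The parametrization of the Lagrangians for `polarDet`. -/
def lagrangianOfPoint (π : R) (digit : ι → R) :
    (R ⊕ ι) ⊕ (R ⊕ ι) ⊕ (Option ι × Option ι) ⊕ Unit →
      Submodule R (Matrix (Fin 2) (Fin 2) R) :=
  Sum.elim (fun x => colSubmodule (liftPoint π digit x))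
    (Sum.elim (fun x => rowSubmodule (liftPoint π digit x))
      (Sum.elim (fun x => mixedSubmodule π (residuePoint digit x.1) (residuePoint digit x.2))
        (fun _ => torsionSubmodule π)))

theorem lagrangianOfPoint_injective (h : IsSquareZeroUniformizer π)
    (hinj : ∀ k l, π * digit k = π * digit l → k = l) :
    Function.Injective (lagrangianOfPoint π digit) := by
  refine Function.Injective.sumElim (fun x y hxy => ?_)
    (Function.Injective.sumElim (fun x y hxy => ?_)
      (Function.Injective.sumElim (fun x y hxy => ?_) (fun _ _ _ => rfl) fun x _ => ?_)
      fun x y => ?_) fun x y => ?_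
  · exact (eq_of_liftPoint_cross h hinj (cross_of_colSubmodule_eq hxy)).symm
  · exact (eq_of_liftPoint_cross h hinj (cross_of_rowSubmodule_eq hxy)).symm
  · have hcross := cross_of_mixedSubmodule_eq (isCoprime_residuePoint _)
      (isCoprime_residuePoint _) hxy
    exact Prod.ext (eq_of_residuePoint_cross h hinj hcross.1).symm
      (eq_of_residuePoint_cross h hinj hcross.2).symm
  · exact h.mixedSubmodule_ne_torsionSubmodule (isCoprime_residuePoint _)
      (isCoprime_residuePoint _)
  · rcases y with y | y
    · exact h.rowSubmodule_ne_mixedSubmodule (isCoprime_residuePoint _) (isCoprime_liftPoint _)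
    · exact h.rowSubmodule_ne_torsionSubmodule (isCoprime_liftPoint _)
  · rcases y with y | y | y
    · exact h.colSubmodule_ne_rowSubmodule (isCoprime_liftPoint _) (isCoprime_liftPoint _)
    · exact h.colSubmodule_ne_mixedSubmodule (isCoprime_liftPoint _) (isCoprime_residuePoint _)
    · exact h.colSubmodule_ne_torsionSubmodule (isCoprime_liftPoint _)

theorem range_lagrangianOfPoint (h : IsSquareZeroUniformizer π) (h2 : IsUnit (2 : R))
    (hsurj : ∀ x, ∃ k y, x = digit k + π * y) :
    Set.range (lagrangianOfPoint π digit) = {L | IsDetLagrangian L} := by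
  ext L
  constructor
  · rintro ⟨x | x | x | x, rfl⟩
    · exact isDetLagrangian_colSubmodule (isCoprime_liftPoint x)
    · exact isDetLagrangian_rowSubmodule (isCoprime_liftPoint x)
    · exact h.isDetLagrangian_mixedSubmodule (isCoprime_residuePoint x.1)
        (isCoprime_residuePoint x.2)
    · exact h.isDetLagrangian_torsionSubmodule
  · intro hL
    obtain rfl | ⟨u, w, hu, hw, rfl | rfl | rfl⟩ := h.classification h2 hL
    · exact ⟨Sum.inr (Sum.inr (Sum.inr ())), rfl⟩
    · obtain ⟨x, hx⟩ := exists_liftPoint_cross h hsurj hu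
      exact ⟨Sum.inl x, (IsDetLagrangian.eq_of_le hL
        (isDetLagrangian_colSubmodule (isCoprime_liftPoint x))
        (colSubmodule_le_of_cross hu hx)).symm⟩
    · obtain ⟨x, hx⟩ := exists_liftPoint_cross h hsurj hw
      exact ⟨Sum.inr (Sum.inl x), (IsDetLagrangian.eq_of_le hL
        (isDetLagrangian_rowSubmodule (isCoprime_liftPoint x))
        (rowSubmodule_le_of_cross hw hx)).symm⟩
    · obtain ⟨x, hx⟩ := exists_residuePoint_cross h hsurj hu
      obtain ⟨y, hy⟩ := exists_residuePoint_cross h hsurj hw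
      exact ⟨Sum.inr (Sum.inr (Sum.inl (x, y))), (IsDetLagrangian.eq_of_le hL
        (h.isDetLagrangian_mixedSubmodule (isCoprime_residuePoint x) (isCoprime_residuePoint y))
        (h.mixedSubmodule_le_of_cross hu hw hx hy)).symm⟩

end Points

/-- The change of coordinates from the diagonal form to the determinant form. -/
def diagonalEquivMatrix {R : Type*} [CommRing R] [Invertible (2 : R)] :
    (Fin 4 → R) ≃ₗ[R] Matrix (Fin 2) (Fin 2) R where
  toFun v := !![v 0 - v 2, v 3 - v 1; v 3 + v 1, v 0 + v 2]
  invFun M := ![⅟2 * (M 1 1 + M 0 0), ⅟2 * (M 1 0 - M 0 1), ⅟2 * (M 1 1 - M 0 0),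
    ⅟2 * (M 1 0 + M 0 1)]
  map_add' v w := by
    ext i j
    fin_cases i <;> fin_cases j <;> simp <;> ring
  map_smul' c v := by
    ext i j
    fin_cases i <;> fin_cases j <;> simp <;> ring
  left_inv v := by
    have h2 : (⅟2 : R) * 2 = 1 := invOf_mul_self 2
    ext i
    fin_cases i <;> simp
    · linear_combination v 0 * h2
    · linear_combination v 1 * h2
    · linear_combination v 2 * h2
    · linear_combination v 3 * h2
  right_inv M := by
    have h2 : (⅟2 : R) * 2 = 1 := invOf_mul_self 2
    ext i j
    fin_cases i <;> fin_cases j <;> simp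
    · linear_combination M 0 0 * h2
    · linear_combination M 0 1 * h2
    · linear_combination M 1 0 * h2
    · linear_combination M 1 1 * h2

theorem polarDet_diagonalEquivMatrix {R : Type*} [CommRing R] [Invertible (2 : R)]
    (v w : Fin 4 → R) : polarDet (diagonalEquivMatrix v) (diagonalEquivMatrix w) =
      2 * (v 0 * w 0 + v 1 * w 1 - v 2 * w 2 - v 3 * w 3) := by
  simp [polarDet, diagonalEquivMatrix]
  ring

theorem isDetLagrangian_map_diagonalEquivMatrix_iff {R : Type*} [CommRing R]
    [Invertible (2 : R)] (L : Submodule R (Fin 4 → R)) :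
    IsDetLagrangian (L.map (diagonalEquivMatrix (R := R)).toLinearMap) ↔
      ∀ v, v ∈ L ↔ ∀ w ∈ L, v 0 * w 0 + v 1 * w 1 - v 2 * w 2 - v 3 * w 3 = 0 := by
  rw [IsDetLagrangian, diagonalEquivMatrix.surjective.forall]
  refine forall_congr' fun v => iff_congr ?_ ?_
  · simp
  · rw [diagonalEquivMatrix.surjective.forall]
    simp [polarDet_diagonalEquivMatrix, (isUnit_of_invertible (2 : R)).mul_right_eq_zero]

theorem isSquareZeroUniformizer_natCast {p : ℕ} (hp : p.Prime) :
    IsSquareZeroUniformizer (p : ZMod (p ^ 2)) where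
  ne_zero h := by
    rw [ZMod.natCast_eq_zero_iff] at h
    have := Nat.le_of_dvd hp.pos h
    nlinarith [hp.two_le]
  mul_self := by
    rw [← Nat.cast_mul, ← pow_two, ZMod.natCast_self]
  isUnit_or x := by
    have : NeZero (p ^ 2) := ⟨pow_ne_zero 2 hp.ne_zero⟩
    rw [← ZMod.natCast_zmod_val x]
    by_cases hx : p ∣ x.val
    · obtain ⟨y, hy⟩ := hx
      exact Or.inr ⟨y, by rw [hy, Nat.cast_mul]⟩
    · exact Or.inl ((ZMod.isUnit_iff_coprime _ _).2
        (((hp.coprime_iff_not_dvd.2 hx).symm).pow_right 2))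

theorem ZMod.exists_eq_digit_add_mul {p : ℕ} (hp : p.Prime) (x : ZMod (p ^ 2)) :
    ∃ (k : Fin p) (y : ZMod (p ^ 2)), x = ((k : ℕ) : ZMod (p ^ 2)) + (p : ZMod (p ^ 2)) * y := by
  have : NeZero (p ^ 2) := ⟨pow_ne_zero 2 hp.ne_zero⟩
  refine ⟨⟨x.val % p, Nat.mod_lt _ hp.pos⟩, ((x.val / p : ℕ) : ZMod (p ^ 2)), ?_⟩
  rw [← Nat.cast_mul, ← Nat.cast_add, Nat.mod_add_div, ZMod.natCast_zmod_val]

theorem ZMod.digit_eq_of_mul_eq {p : ℕ} (hp : p.Prime) (k l : Fin p)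
    (h : (p : ZMod (p ^ 2)) * ((k : ℕ) : ZMod (p ^ 2)) = p * ((l : ℕ) : ZMod (p ^ 2))) :
    k = l := by
  rw [← Nat.cast_mul, ← Nat.cast_mul, ZMod.natCast_eq_natCast_iff, pow_two] at h
  exact Fin.ext ((Nat.ModEq.mul_left_cancel' hp.ne_zero h).eq_of_lt_of_lt k.2 l.2)

/-- The number of `ZMod p²`-submodules of `(ZMod p²)⁴` that are Lagrangian with respect
to `b(x,y) = x₁y₁ + x₂y₂ − x₃y₃ − x₄y₄` equals `3p² + 4p + 2` (`p` an odd prime). -/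
theorem lagrangian_count_rank4 (p : ℕ) (hp : p.Prime) (hodd : Odd p) :
    Nat.card {L : Submodule (ZMod (p ^ 2)) (Fin 4 → ZMod (p ^ 2)) //
      ∀ v, v ∈ L ↔ ∀ w ∈ L, v 0 * w 0 + v 1 * w 1 - v 2 * w 2 - v 3 * w 3 = 0} =
    3 * p ^ 2 + 4 * p + 2 := by
  have : NeZero (p ^ 2) := ⟨pow_ne_zero 2 hp.ne_zero⟩
  have h2 : IsUnit (2 : ZMod (p ^ 2)) := by
    have := (ZMod.isUnit_iff_coprime 2 (p ^ 2)).2 (hodd.coprime_two_left.pow_right 2)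
    simpa using this
  let := h2.invertible
  have h := isSquareZeroUniformizer_natCast hp
  let digit (k : Fin p) : ZMod (p ^ 2) := ((k : ℕ) : ZMod (p ^ 2))
  calc
    _ = Nat.card {L : Submodule (ZMod (p ^ 2)) (Matrix (Fin 2) (Fin 2) (ZMod (p ^ 2))) //
          IsDetLagrangian L} :=
      Nat.card_congr <| (Submodule.orderIsoMapComap diagonalEquivMatrix).toEquiv.subtypeEquiv
        fun L => (isDetLagrangian_map_diagonalEquivMatrix_iff L).symm
    _ = Nat.card (Set.range (lagrangianOfPoint (p : ZMod (p ^ 2)) digit)) := by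
      rw [range_lagrangianOfPoint h h2 (ZMod.exists_eq_digit_add_mul hp)]
      rfl
    _ = Nat.card ((ZMod (p ^ 2) ⊕ Fin p) ⊕ (ZMod (p ^ 2) ⊕ Fin p) ⊕
          (Option (Fin p) × Option (Fin p)) ⊕ Unit) :=
      Nat.card_range_of_injective (lagrangianOfPoint_injective h (ZMod.digit_eq_of_mul_eq hp))
    _ = 3 * p ^ 2 + 4 * p + 2 := by
      simp only [Nat.card_eq_fintype_card, Fintype.card_sum, Fintype.card_prod,
        Fintype.card_option, Fintype.card_fin, Fintype.card_unit, ZMod.card]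
      ring
end

section
/- Let p be an odd prime. The number of 2×2 matrices M over ZMod p² satisfying Mᵀ · M = I equals 2p(p+1) if p ≡ 3 (mod 4) and equals 2p(p−1) if p ≡ 1 (mod 4). -/
open Matrix

/-- An orthogonal `2×2` matrix is determined by its determinant, a square root of `1`, and its
first column, a point of the unit circle. -/
def orthogonalMatrixEquiv (R : Type*) [CommRing R] :
    {M : Matrix (Fin 2) (Fin 2) R // Mᵀ * M = 1} ≃
      {e : R // e ^ 2 = 1} × {v : R × R // v.1 ^ 2 + v.2 ^ 2 = 1} where
  toFun M := (⟨M.1.det, by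
      have h := congrArg Matrix.det M.2
      rwa [det_mul, det_transpose, det_one, ← sq] at h⟩,
    ⟨(M.1 0 0, M.1 1 0), by
      have h := congrFun (congrFun M.2 0) 0
      simpa [Matrix.mul_apply, Fin.sum_univ_two, sq] using h⟩)
  invFun x := ⟨!![x.2.1.1, -(x.1.1 * x.2.1.2); x.2.1.2, x.1.1 * x.2.1.1], by
    obtain ⟨⟨e, he⟩, ⟨⟨a, b⟩, hab⟩⟩ := x
    simp only at hab
    ext i j
    fin_cases i <;> fin_cases j <;> simp [Matrix.mul_apply, Fin.sum_univ_two]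
    · linear_combination hab
    · ring
    · ring
    · linear_combination e ^ 2 * hab + he⟩
  left_inv := by
    rintro ⟨M, hM⟩
    have h00 := congrFun (congrFun hM 0) 0
    have h01 := congrFun (congrFun hM 0) 1
    simp only [Matrix.mul_apply, Fin.sum_univ_two, transpose_apply, one_apply_eq, ne_eq,
      zero_ne_one, not_false_eq_true, one_apply_ne] at h00 h01
    ext i j
    fin_cases i <;> fin_cases j <;> simp [det_fin_two]
    · linear_combination M 0 1 * h00 - M 0 0 * h01
    · linear_combination M 1 1 * h00 - M 1 0 * h01
  right_inv := by
    rintro ⟨⟨e, he⟩, ⟨⟨a, b⟩, hab⟩⟩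
    simp only at hab
    ext <;> simp [det_fin_two]
    linear_combination e * hab

/-- In a local ring where `2` is invertible, the only square roots of `1` are `±1`. -/
theorem card_sq_eq_one {R : Type*} [CommRing R] [IsLocalRing R] (h2 : IsUnit (2 : R)) :
    Nat.card {e : R // e ^ 2 = 1} = 2 := by
  have hset : {e : R | e ^ 2 = 1} = {1, -1} := by
    ext e
    simp only [Set.mem_ofPred_eq, Set.mem_insert_iff, Set.mem_singleton_iff]
    refine ⟨fun he => ?_, by rintro (rfl | rfl) <;> ring⟩
    have hmul : (e + 1) * (e - 1) = 0 := by linear_combination he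
    have hsum : IsUnit ((e + 1) + (-(e - 1))) := by
      convert h2 using 1
      ring
    rcases IsLocalRing.isUnit_or_isUnit_of_isUnit_add hsum with h | h
    · exact Or.inl (sub_eq_zero.1 (h.mul_right_eq_zero.1 hmul))
    · exact Or.inr (eq_neg_of_add_eq_zero_left
        (((IsUnit.neg_iff _).1 h).mul_left_eq_zero.1 hmul))
  have hne : (1 : R) ≠ -1 := fun h => h2.ne_zero (by linear_combination h)
  calc Nat.card {e : R // e ^ 2 = 1} = Set.ncard {e : R | e ^ 2 = 1} := rfl
    _ = 2 := by rw [hset, Set.ncard_pair hne]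

/-- When `-1` is a square and `2` is invertible, the unit circle is parametrized by the units,
via `(a, b) ↦ a + i b`. -/
noncomputable def circleEquivUnits {R : Type*} [CommRing R] {i : R} (hi : i ^ 2 = -1)
    (h2 : IsUnit (2 : R)) : {v : R × R // v.1 ^ 2 + v.2 ^ 2 = 1} ≃ Rˣ where
  toFun v := ⟨v.1.1 + i * v.1.2, v.1.1 - i * v.1.2,
    by linear_combination v.2 - v.1.2 ^ 2 * hi, by linear_combination v.2 - v.1.2 ^ 2 * hi⟩
  invFun u := ⟨(Ring.inverse 2 * (u + (u⁻¹ : Rˣ)), -i * Ring.inverse 2 * (u - (u⁻¹ : Rˣ))), by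
    have hh := Ring.mul_inverse_cancel _ h2
    have hu := u.mul_inv
    linear_combination Ring.inverse 2 ^ 2 * ((u : R) - (u⁻¹ : Rˣ)) ^ 2 * hi
      + 4 * Ring.inverse 2 ^ 2 * hu + (2 * Ring.inverse 2 + 1) * hh⟩
  left_inv := by
    rintro ⟨⟨a, b⟩, hab⟩
    have hh := Ring.mul_inverse_cancel _ h2
    ext <;> simp only [Units.inv_mk]
    · linear_combination a * hh
    · linear_combination b * hh - 2 * Ring.inverse 2 * b * hi
  right_inv u := by
    have hh := Ring.mul_inverse_cancel _ h2
    ext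
    simp only
    linear_combination (u : R) * hh - Ring.inverse 2 * ((u : R) - (u⁻¹ : Rˣ)) * hi

/-- When `1 + t ^ 2` is always invertible, stereographic projection from `(-1, 0)` parametrizes
by `R` the points of the unit circle with `1 + a` invertible. -/
noncomputable def stereographicEquiv {R : Type*} [CommRing R] (h2 : IsUnit (2 : R))
    (hsq : ∀ t : R, IsUnit (1 + t ^ 2)) :
    {v : {v : R × R // v.1 ^ 2 + v.2 ^ 2 = 1} // IsUnit (1 + v.1.1)} ≃ R where
  toFun v := v.1.1.2 * Ring.inverse (1 + v.1.1.1)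
  invFun t := ⟨⟨((1 - t ^ 2) * Ring.inverse (1 + t ^ 2), 2 * t * Ring.inverse (1 + t ^ 2)), by
      have h := Ring.mul_inverse_cancel _ (hsq t)
      linear_combination ((1 + t ^ 2) * Ring.inverse (1 + t ^ 2) + 1) * h⟩, by
    have h := Ring.mul_inverse_cancel _ (hsq t)
    have he : 1 + (1 - t ^ 2) * Ring.inverse (1 + t ^ 2) = 2 * Ring.inverse (1 + t ^ 2) := by
      linear_combination -h
    simp only [he]
    exact h2.mul (hsq t).ringInverse⟩
  left_inv := by
    rintro ⟨⟨⟨a, b⟩, hab⟩, ha⟩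
    simp only at hab ha
    have h := Ring.mul_inverse_cancel _ ha
    set s := Ring.inverse (1 + a)
    have ht := Ring.mul_inverse_cancel _ (hsq (b * s))
    set w := Ring.inverse (1 + (b * s) ^ 2)
    have hs : (1 + (b * s) ^ 2) = 2 * s := by
      linear_combination s ^ 2 * hab + (1 + (a - 1) * s) * (-h)
    have hw : 2 * w = 1 + a := by
      linear_combination (1 + a) * ht - (1 + a) * w * hs - 2 * w * h
    ext
    · simp only
      linear_combination hw - ht
    · simp only
      linear_combination b * s * hw + b * h
  right_inv t := by
    have h := Ring.mul_inverse_cancel _ (hsq t)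
    have he : 1 + (1 - t ^ 2) * Ring.inverse (1 + t ^ 2) = 2 * Ring.inverse (1 + t ^ 2) := by
      linear_combination -h
    have hv := Ring.mul_inverse_cancel _ (h2.mul (hsq t).ringInverse)
    simp only [he]
    linear_combination t * hv

/-- When `1 + t ^ 2` is always invertible, stereographic projection from `(1, 0)` parametrizes
by the nonunits the points of the unit circle with `1 + a` not invertible. -/
noncomputable def stereographicNonunitsEquiv {R : Type*} [CommRing R] [IsLocalRing R]
    (h2 : IsUnit (2 : R)) (hsq : ∀ t : R, IsUnit (1 + t ^ 2)) :
    {v : {v : R × R // v.1 ^ 2 + v.2 ^ 2 = 1} // ¬ IsUnit (1 + v.1.1)} ≃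
      {t : R // ¬ IsUnit t} :=
  let reflect : {v : R × R // v.1 ^ 2 + v.2 ^ 2 = 1} ≃ {v : R × R // v.1 ^ 2 + v.2 ^ 2 = 1} :=
    ((Equiv.neg R).prodCongr (Equiv.refl R)).subtypeEquiv fun v => by simp
  have isUnit_add (v : {v : R × R // v.1 ^ 2 + v.2 ^ 2 = 1}) (hv : ¬ IsUnit (1 - v.1.1)) :
      IsUnit (1 + v.1.1) := by
    have hsum : IsUnit ((1 + v.1.1) + (1 - v.1.1)) := by
      convert h2 using 1
      ring
    exact (IsLocalRing.isUnit_or_isUnit_of_isUnit_add hsum).resolve_right hv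
  (reflect.subtypeEquiv (q := fun v => ¬ IsUnit (1 - v.1.1)) fun v => by simp [reflect]).trans <|
    (Equiv.subtypeSubtypeEquivSubtype (isUnit_add _)).symm.trans <|
      (stereographicEquiv h2 hsq).subtypeEquiv fun v => by
        have hb : v.1.1.2 ^ 2 = (1 + v.1.1.1) * (1 - v.1.1.1) := by linear_combination v.1.2
        have hiff : IsUnit (1 - v.1.1.1) ↔ IsUnit v.1.1.2 := by
          rw [← isUnit_pow_iff (a := v.1.1.2) two_ne_zero, hb, IsUnit.mul_iff, and_iff_right v.2]
        simp only [stereographicEquiv, Equiv.coe_fn_mk]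
        rw [hiff, IsUnit.mul_iff, and_iff_left v.2.ringInverse]

theorem card_circle_eq_add_card_nonunits {R : Type*} [CommRing R] [IsLocalRing R] [Finite R]
    (h2 : IsUnit (2 : R)) (hsq : ∀ t : R, IsUnit (1 + t ^ 2)) :
    Nat.card {v : R × R // v.1 ^ 2 + v.2 ^ 2 = 1} =
      Nat.card R + Nat.card {t : R // ¬ IsUnit t} := by
  classical
  rw [← Nat.card_congr (Equiv.sumCompl fun v : {v : R × R // v.1 ^ 2 + v.2 ^ 2 = 1} =>
    IsUnit (1 + v.1.1)), Nat.card_sum, Nat.card_congr (stereographicEquiv h2 hsq),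
    Nat.card_congr (stereographicNonunitsEquiv h2 hsq)]

theorem card_units_add_card_nonunits (R : Type*) [Monoid R] [Finite R] :
    Nat.card Rˣ + Nat.card {t : R // ¬ IsUnit t} = Nat.card R := by
  classical
  have e : Rˣ ≃ {t : R // IsUnit t} := (Submonoid.unitsTypeEquivIsUnitSubmonoid (M := R)).toEquiv
  rw [Nat.card_congr e, ← Nat.card_sum, Nat.card_congr (Equiv.sumCompl fun t : R => IsUnit t)]

theorem ZMod.isUnit_two_of_odd {n : ℕ} (hodd : Odd n) : IsUnit (2 : ZMod n) := by
  have h := (ZMod.isUnit_iff_coprime 2 n).2 (Nat.coprime_two_left.2 hodd)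
  exact_mod_cast h

section ZModPrimeSq

variable (p : ℕ) [hp : Fact p.Prime]

instance ZMod.isLocalRing_prime_sq : IsLocalRing (ZMod (p ^ 2)) :=
  have : Fact (1 < p ^ 2) := ⟨Nat.one_lt_pow two_ne_zero hp.out.one_lt⟩
  IsLocalRing.of_surjective' (PadicInt.toZModPow 2) (ZMod.ringHom_surjective _)

theorem ZMod.card_units_prime_sq : Nat.card (ZMod (p ^ 2))ˣ = p * (p - 1) := by
  have : NeZero (p ^ 2) := ⟨pow_ne_zero _ hp.out.ne_zero⟩
  rw [Nat.card_eq_fintype_card, ZMod.card_units_eq_totient,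
    Nat.totient_prime_pow hp.out two_pos]
  simp

variable {p}

theorem ZMod.isUnit_one_add_sq (hp3 : p % 4 = 3) (t : ZMod (p ^ 2)) : IsUnit (1 + t ^ 2) := by
  let f : ZMod (p ^ 2) →+* ZMod p := ZMod.castHom (dvd_pow_self p two_ne_zero) (ZMod p)
  have : IsLocalHom f := (ZMod.ringHom_surjective f).isLocalHom
  refine isUnit_of_map_unit f _ (IsUnit.mk0 _ fun h => ?_)
  refine ZMod.exists_sq_eq_neg_one_iff.1 ⟨f t, ?_⟩ hp3
  rw [map_add, map_one, map_pow] at h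
  linear_combination -h

theorem ZMod.exists_sq_eq_neg_one_prime_sq (hp1 : p % 4 = 1) :
    ∃ i : ZMod (p ^ 2), i ^ 2 = -1 := by
  obtain ⟨y, hy⟩ := ZMod.exists_sq_eq_neg_one_iff (p := p).2 (by lia)
  obtain ⟨x, rfl⟩ := ZMod.intCast_surjective y
  have hdvd : (p : ℤ) ∣ x ^ 2 - (-1) := by
    rw [← ZMod.intCast_zmod_eq_zero_iff_dvd]
    push_cast
    linear_combination -hy
  have hpow := dvd_sub_pow_of_dvd_sub hdvd 1
  have hodd : Odd p := Nat.odd_iff.2 (by lia)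
  refine ⟨(x : ZMod (p ^ 2)) ^ p, ?_⟩
  have hzero := (ZMod.intCast_zmod_eq_zero_iff_dvd _ (p ^ 2)).2 (by exact_mod_cast hpow)
  push_cast [hodd.neg_one_pow, pow_one] at hzero
  rw [pow_right_comm]
  linear_combination hzero

end ZModPrimeSq

/-- The number of `2×2` matrices `M` over `ZMod p²` with `Mᵀ · M = I` equals `2p(p+1)`
when `p ≡ 3 (mod 4)` and `2p(p−1)` when `p ≡ 1 (mod 4)`, for `p` an odd prime. -/
theorem orthogonal_group_count (p : ℕ) (hp : p.Prime) (hodd : Odd p) :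
    (p % 4 = 3 →
      Nat.card {M : Matrix (Fin 2) (Fin 2) (ZMod (p ^ 2)) // Mᵀ * M = 1} =
        2 * p * (p + 1)) ∧
    (p % 4 = 1 →
      Nat.card {M : Matrix (Fin 2) (Fin 2) (ZMod (p ^ 2)) // Mᵀ * M = 1} =
        2 * p * (p - 1)) := by
  have : Fact p.Prime := ⟨hp⟩
  have : NeZero (p ^ 2) := ⟨pow_ne_zero _ hp.ne_zero⟩
  have h2 : IsUnit (2 : ZMod (p ^ 2)) := ZMod.isUnit_two_of_odd hodd.pow
  rw [Nat.card_congr (orthogonalMatrixEquiv _), Nat.card_prod, card_sq_eq_one h2, mul_assoc,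
    mul_assoc]
  refine ⟨fun hp3 => ?_, fun hp1 => ?_⟩
  · have hunits := card_units_add_card_nonunits (ZMod (p ^ 2))
    rw [ZMod.card_units_prime_sq, Nat.card_zmod] at hunits
    rw [card_circle_eq_add_card_nonunits h2 (ZMod.isUnit_one_add_sq hp3), Nat.card_zmod]
    obtain ⟨q, rfl⟩ := Nat.exists_eq_add_of_lt hp.pos
    simp only [zero_add, Nat.add_sub_cancel] at hunits ⊢
    linarith
  · obtain ⟨i, hi⟩ := ZMod.exists_sq_eq_neg_one_prime_sq hp1
    rw [Nat.card_congr (circleEquivUnits hi h2), ZMod.card_units_prime_sq]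
end

section
/- Let p be an odd prime. Consider the ℤ-module G = ZMod p² × ZMod p × ZMod p² × ZMod p, equipped with the ZMod p²-valued bilinear pairing b((a,b,c,d),(a′,b′,c′,d′)) = a·a′ + p·(b.val·b′.val) − c·c′ − p·(d.val·d′.val), where b.val denotes the natural-number representative of an element of ZMod p (this is well defined modulo p²). Then the number of subgroups L of G satisfying L = L^⊥ := {v ∈ G : b(v,w) = 0 for all w ∈ L} equals 4p + 2. -/
/-- The `ZMod p²`-valued bilinear pairing on `G = ZMod p² × ZMod p × ZMod p² × ZMod p`:
`b((a,b,c,d),(a′,b′,c′,d′)) = a·a′ + p·(b.val·b′.val) − c·c′ − p·(d.val·d′.val)`. -/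
def pairingB (p : ℕ) (v w : ZMod (p ^ 2) × ZMod p × ZMod (p ^ 2) × ZMod p) :
    ZMod (p ^ 2) :=
  v.1 * w.1 + ((p * (v.2.1.val * w.2.1.val) : ℕ) : ZMod (p ^ 2)) -
    v.2.2.1 * w.2.2.1 - ((p * (v.2.2.2.val * w.2.2.2.val) : ℕ) : ZMod (p ^ 2))

/-- A square-zero extension `0 → F → R → F → 0` of a field by itself, with projection `π` and
inclusion `φ`. -/
structure IsSquareZeroExt {R F : Type*} [CommRing R] [Field F] (π : R →+* F) (φ : F →+ R) :
    Prop where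
  smul : ∀ a x, a * φ x = φ (π a * x)
  inj : Function.Injective φ
  surj : Function.Surjective π
  proj : ∀ x, π (φ x) = 0
  ker : ∀ a, π a = 0 → ∃ x, a = φ x

/-- A set equal to its own orthogonal complement. -/
def IsLagrangian {M R : Type*} [Zero R] (B : M → M → R) (S : Set M) : Prop :=
  ∀ v, v ∈ S ↔ ∀ w ∈ S, B v w = 0

theorem IsLagrangian.eq_of_subset {M R : Type*} [Zero R] {B : M → M → R} {S T : Set M}
    (hS : IsLagrangian B S) (hT : IsLagrangian B T) (h : S ⊆ T) : S = T :=
  h.antisymm fun v hv => (hS v).2 fun w hw => (hT v).1 hv w (h hw)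

theorem IsLagrangian.preimage {M N R : Type*} [Zero R] {B : M → M → R} {C : N → N → R}
    {S : Set M} (hS : IsLagrangian B S) (e : N ≃ M)
    (he : ∀ v w, C v w = 0 ↔ B (e v) (e w) = 0) : IsLagrangian C (e ⁻¹' S) := by
  intro v
  rw [Set.mem_preimage, hS]
  constructor
  · intro h w hw
    exact (he v w).2 (h _ hw)
  · intro h w hw
    have := (he v (e.symm w)).1 (h _ (by simpa using hw))
    simpa using this

section Hyperbolic

variable {R F : Type*} [CommRing R] [Field F] {π : R →+* F} {φ : F →+ R}

/-- The hyperbolic pairing on `R × F × R × F`. -/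
def hyperbolicPairing (φ : F →+ R) (x y : R × F × R × F) : R :=
  x.1 * y.2.2.1 + x.2.2.1 * y.1 + φ (x.2.1 * y.2.2.2 + x.2.2.2 * y.2.1)

/-- The Lagrangians that contain an element whose first coordinate is a unit (first two families),
whose third coordinate is a unit (next two families), or neither (last two). -/
def lagrangianFamily (π : R →+* F) (φ : F →+ R) :
    ((F ⊕ F) ⊕ (F ⊕ F)) ⊕ Bool → Set (R × F × R × F)
  | .inl (.inl (.inl c)) => {x | x.2.2.2 = π x.1 * c ∧ x.2.2.1 = -φ (x.2.1 * c)}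
  | .inl (.inl (.inr c)) => {x | x.2.1 = π x.1 * c ∧ x.2.2.1 = -φ (x.2.2.2 * c)}
  | .inl (.inr (.inl c)) => {x | x.2.2.2 = π x.2.2.1 * c ∧ x.1 = -φ (x.2.1 * c)}
  | .inl (.inr (.inr c)) => {x | x.2.1 = π x.2.2.1 * c ∧ x.1 = -φ (x.2.2.2 * c)}
  | .inr true => {x | π x.1 = 0 ∧ π x.2.2.1 = 0 ∧ x.2.1 = 0}
  | .inr false => {x | π x.1 = 0 ∧ π x.2.2.1 = 0 ∧ x.2.2.2 = 0}

/-- Exchange of the two isotropic coordinates over `R`. -/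
def swapOuter (R F : Type*) : R × F × R × F ≃ R × F × R × F where
  toFun x := (x.2.2.1, x.2.1, x.1, x.2.2.2)
  invFun x := (x.2.2.1, x.2.1, x.1, x.2.2.2)
  left_inv _ := rfl
  right_inv _ := rfl

/-- Exchange of the two isotropic coordinates over `F`. -/
def swapInner (R F : Type*) : R × F × R × F ≃ R × F × R × F where
  toFun x := (x.1, x.2.2.2, x.2.2.1, x.2.1)
  invFun x := (x.1, x.2.2.2, x.2.2.1, x.2.1)
  left_inv _ := rfl
  right_inv _ := rfl

theorem hyperbolicPairing_swapOuter (x y : R × F × R × F) :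
    hyperbolicPairing φ (swapOuter R F x) (swapOuter R F y) = hyperbolicPairing φ x y := by
  simp only [hyperbolicPairing, swapOuter, Equiv.coe_fn_mk]
  ring

theorem hyperbolicPairing_swapInner (x y : R × F × R × F) :
    hyperbolicPairing φ (swapInner R F x) (swapInner R F y) = hyperbolicPairing φ x y := by
  simp only [hyperbolicPairing, swapInner, Equiv.coe_fn_mk]
  rw [add_comm (x.2.2.2 * _)]

namespace IsSquareZeroExt

theorem map_eq_zero (h : IsSquareZeroExt π φ) {x : F} : φ x = 0 ↔ x = 0 :=
  map_eq_zero_iff φ h.inj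

theorem smul' (h : IsSquareZeroExt π φ) (a : R) (x : F) : φ x * a = φ (π a * x) := by
  rw [mul_comm, h.smul]

theorem exists_inv (h : IsSquareZeroExt π φ) {s : R} (hs : π s ≠ 0) : ∃ r, r * s = 1 := by
  obtain ⟨r, hr⟩ := h.surj (π s)⁻¹
  obtain ⟨x, hx⟩ := h.ker (r * s - 1) (by simp [hr, hs])
  have hx2 : φ x * φ x = 0 := by rw [h.smul, h.proj]; simp
  refine ⟨r * (1 - φ x), ?_⟩
  have : r * s = 1 + φ x := by rw [← hx]; ring
  linear_combination (1 - φ x) * this - hx2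

theorem isLagrangian_inl_inl_inl (h : IsSquareZeroExt π φ) (c : F) :
    IsLagrangian (hyperbolicPairing φ) (lagrangianFamily π φ (.inl (.inl (.inl c)))) := by
  rintro ⟨s, u, t, v⟩
  simp only [lagrangianFamily, Set.mem_ofPred_eq, hyperbolicPairing, Prod.forall]
  constructor
  · rintro ⟨rfl, rfl⟩ s' u' t' v' ⟨rfl, rfl⟩
    rw [mul_neg, neg_mul, h.smul, h.smul', ← map_neg, ← map_neg, ← map_add, ← map_add,
      h.map_eq_zero]
    ring
  · intro H
    have h₁ := H 1 0 0 c (by simp)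
    have h₂ := H 0 1 (-φ c) 0 (by simp)
    simp only [mul_neg, h.smul, mul_zero, mul_one, zero_add, add_zero] at h₁ h₂
    rw [← map_neg, ← map_add, h.map_eq_zero] at h₂
    exact ⟨by linear_combination h₂, by linear_combination h₁⟩

theorem isLagrangian_inr_true (h : IsSquareZeroExt π φ) :
    IsLagrangian (hyperbolicPairing φ) (lagrangianFamily π φ (.inr true)) := by
  rintro ⟨s, u, t, v⟩
  simp only [lagrangianFamily, Set.mem_ofPred_eq, hyperbolicPairing, Prod.forall]
  constructor
  · rintro ⟨hs, ht, rfl⟩ s' u' t' v' ⟨hs', ht', rfl⟩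
    obtain ⟨a, rfl⟩ := h.ker _ hs
    obtain ⟨b, rfl⟩ := h.ker _ ht
    simp [h.smul', hs', ht']
  · intro H
    have h₁ := H (φ 1) 0 0 0 (by simp [h.proj])
    have h₂ := H 0 0 (φ 1) 0 (by simp [h.proj])
    have h₃ := H 0 0 0 1 (by simp)
    simp only [h.smul, mul_zero, mul_one, zero_add, add_zero, map_zero, h.map_eq_zero]
      at h₁ h₂ h₃
    exact ⟨h₂, h₁, h₃⟩

theorem isLagrangian_family (h : IsSquareZeroExt π φ) (i) :
    IsLagrangian (hyperbolicPairing φ) (lagrangianFamily π φ i) := by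
  have ho (x y : R × F × R × F) : hyperbolicPairing φ x y = 0 ↔
      hyperbolicPairing φ (swapOuter R F x) (swapOuter R F y) = 0 := by
    rw [hyperbolicPairing_swapOuter]
  have hi (x y : R × F × R × F) : hyperbolicPairing φ x y = 0 ↔
      hyperbolicPairing φ (swapInner R F x) (swapInner R F y) = 0 := by
    rw [hyperbolicPairing_swapInner]
  have h₁ := h.isLagrangian_inl_inl_inl
  rcases i with ((c | c) | (c | c)) | (_ | _)
  · exact h₁ c
  · exact (h₁ c).preimage (swapInner R F) hi
  · exact (h₁ c).preimage (swapOuter R F) ho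
  · exact ((h₁ c).preimage (swapInner R F) hi).preimage (swapOuter R F) ho
  · exact h.isLagrangian_inr_true.preimage (swapInner R F) hi
  · exact h.isLagrangian_inr_true

theorem family_injective (h : IsSquareZeroExt π φ) :
    Function.Injective (lagrangianFamily π φ) := by
  intro i j hij
  rw [Set.ext_iff] at hij
  have := π.domain_nontrivial
  have h₁ c := hij (1, 0, 0, c)
  have h₂ c := hij (1, c, 0, 0)
  have h₃ c := hij (0, 0, 1, c)
  have h₄ c := hij (0, c, 1, 0)
  have h₅ c := hij (0, 1, -φ c, 0)
  have h₆ c := hij (-φ c, 1, 0, 0)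
  have h₇ := hij (0, 1, 0, 0)
  clear hij
  rcases i with ((c | c) | (c | c)) | (_ | _) <;> rcases j with ((d | d) | (d | d)) | (_ | _)
  all_goals simp [lagrangianFamily] at *
  all_goals grind [h.map_eq_zero, h.proj]

/-- A Lagrangian that contains an element whose first coordinate is a unit. -/
theorem exists_family_eq_of_unit (h : IsSquareZeroExt π φ) (h2 : (2 : F) ≠ 0)
    {S : Set (R × F × R × F)} (hS : IsLagrangian (hyperbolicPairing φ) S)
    {x : R × F × R × F} (hx : x ∈ S) (hxs : π x.1 ≠ 0) :
    ∃ i, lagrangianFamily π φ (.inl (.inl i)) = S := by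
  obtain ⟨r, hr⟩ := h.exists_inv hxs
  obtain ⟨s, u, t, v⟩ := x
  obtain ⟨u₀, t₀, v₀, he⟩ : ∃ u₀ t₀ v₀, ((1, u₀, t₀, v₀) : R × F × R × F) ∈ S := by
    refine ⟨π r * u, r * t, π r * v, (hS _).2 fun w hw => ?_⟩
    have := (hS _).1 hx w hw
    simp only [hyperbolicPairing] at this hr ⊢
    rw [← hr, show π r * u * w.2.2.2 + π r * v * w.2.1 = π r * (u * w.2.2.2 + v * w.2.1) by ring,
      ← h.smul]
    linear_combination r * this
  have ht₀ : t₀ = -φ (u₀ * v₀) := by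
    obtain ⟨r₂, hr₂⟩ := h.exists_inv (s := 2) (by rwa [map_ofNat])
    have := (hS _).1 he _ he
    simp only [hyperbolicPairing] at this
    rw [mul_comm v₀, map_add] at this
    linear_combination r₂ * this - (t₀ + φ (u₀ * v₀)) * hr₂
  have ht : ∀ y ∈ S, y.2.2.1 = φ (π y.1 * (u₀ * v₀) - y.2.1 * v₀ - y.2.2.2 * u₀) := by
    intro y hy
    have := (hS _).1 hy _ he
    simp only [hyperbolicPairing, ht₀, map_add, mul_neg, h.smul] at this
    rw [map_sub, map_sub]
    linear_combination this
  have hmul : ∀ y ∈ S, ∀ z ∈ S, (y.2.1 - π y.1 * u₀) * (z.2.2.2 - π z.1 * v₀) +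
      (z.2.1 - π z.1 * u₀) * (y.2.2.2 - π y.1 * v₀) = 0 := by
    intro y hy z hz
    have := (hS _).1 hy _ hz
    rw [hyperbolicPairing, ht y hy, ht z hz, h.smul, h.smul', ← map_add, ← map_add,
      h.map_eq_zero] at this
    linear_combination this
  have hself : ∀ y ∈ S, y.2.1 - π y.1 * u₀ = 0 ∨ y.2.2.2 - π y.1 * v₀ = 0 := by
    intro y hy
    have := hmul y hy y hy
    rw [← two_mul] at this
    simpa [h2] using this
  by_cases hv : ∀ y ∈ S, y.2.2.2 - π y.1 * v₀ = 0
  · refine ⟨.inl v₀, (hS.eq_of_subset (h.isLagrangian_family _) fun y hy => ?_).symm⟩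
    have hy' := sub_eq_zero.1 (hv y hy)
    refine ⟨hy', ?_⟩
    rw [ht y hy, ← map_neg, hy']
    congr 1
    ring
  · push Not at hv
    obtain ⟨y, hy, hyv⟩ := hv
    have hyu := (hself y hy).resolve_right hyv
    refine ⟨.inr u₀, (hS.eq_of_subset (h.isLagrangian_family _) fun z hz => ?_).symm⟩
    have hz' : z.2.1 = π z.1 * u₀ := by
      have := hmul y hy z hz
      simpa [hyu, hyv, sub_eq_zero] using this
    refine ⟨hz', ?_⟩
    rw [ht z hz, ← map_neg, hz']
    congr 1
    ring

theorem exists_family_eq (h : IsSquareZeroExt π φ) (h2 : (2 : F) ≠ 0)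
    {S : Set (R × F × R × F)} (hS : IsLagrangian (hyperbolicPairing φ) S) :
    ∃ i, lagrangianFamily π φ i = S := by
  by_cases hs : ∃ x ∈ S, π x.1 ≠ 0
  · obtain ⟨x, hx, hxs⟩ := hs
    obtain ⟨i, hi⟩ := h.exists_family_eq_of_unit h2 hS hx hxs
    exact ⟨_, hi⟩
  by_cases ht : ∃ x ∈ S, π x.2.2.1 ≠ 0
  · obtain ⟨x, hx, hxt⟩ := ht
    obtain ⟨i, hi⟩ := h.exists_family_eq_of_unit h2
      (hS.preimage (swapOuter R F) fun x y => by rw [hyperbolicPairing_swapOuter])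
      (x := swapOuter R F x) hx hxt
    have hS' : swapOuter R F ⁻¹' (swapOuter R F ⁻¹' S) = S := rfl
    rw [← hi] at hS'
    rcases i with c | c
    · exact ⟨.inl (.inr (.inl c)), hS'⟩
    · exact ⟨.inl (.inr (.inr c)), hS'⟩
  push Not at hs ht
  have hmul : ∀ y ∈ S, ∀ z ∈ S, y.2.1 * z.2.2.2 + y.2.2.2 * z.2.1 = 0 := by
    intro y hy z hz
    have := (hS _).1 hy _ hz
    obtain ⟨a, ha⟩ := h.ker _ (hs y hy)
    obtain ⟨b, hb⟩ := h.ker _ (ht y hy)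
    rwa [hyperbolicPairing, ha, hb, h.smul', h.smul', hs z hz, ht z hz, zero_mul, zero_mul,
      map_zero, add_zero, zero_add, h.map_eq_zero] at this
  by_cases hv : ∀ y ∈ S, y.2.2.2 = 0
  · exact ⟨.inr false, (hS.eq_of_subset (h.isLagrangian_family (.inr false)) fun y hy =>
      ⟨hs y hy, ht y hy, hv y hy⟩).symm⟩
  · push Not at hv
    obtain ⟨y, hy, hyv⟩ := hv
    have hyu : y.2.1 = 0 := by
      have := hmul y hy y hy
      rw [mul_comm y.2.2.2, ← two_mul] at this
      simpa [h2, hyv] using this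
    refine ⟨.inr true, (hS.eq_of_subset (h.isLagrangian_family (.inr true)) fun z hz =>
      ⟨hs z hz, ht z hz, ?_⟩).symm⟩
    simpa [hyu, hyv] using hmul y hy z hz

theorem card_isLagrangian [Finite F] (h : IsSquareZeroExt π φ) (h2 : (2 : F) ≠ 0) :
    Nat.card {S // IsLagrangian (hyperbolicPairing φ) S} = 4 * Nat.card F + 2 := by
  have hbij : Function.Bijective fun i =>
      (⟨lagrangianFamily π φ i, h.isLagrangian_family i⟩ :
        {S // IsLagrangian (hyperbolicPairing φ) S}) :=
    ⟨fun i j hij => h.family_injective (congrArg Subtype.val hij), fun S =>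
      (h.exists_family_eq h2 S.2).imp fun _ => Subtype.ext⟩
  rw [← Nat.card_eq_of_bijective _ hbij, Nat.card_sum, Nat.card_sum, Nat.card_sum]
  simp only [Nat.card_eq_fintype_card, Fintype.card_bool]
  ring

end IsSquareZeroExt

/-- The pairing `⟨1, 1, -1, -1⟩` on `R × F × R × F`. -/
def diagonalPairing (φ : F →+ R) (x y : R × F × R × F) : R :=
  x.1 * y.1 + φ (x.2.1 * y.2.1) - x.2.2.1 * y.2.2.1 - φ (x.2.2.2 * y.2.2.2)

/-- The change of coordinates from the diagonal to the hyperbolic pairing. -/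
def diagonalToHyperbolic (π : R →+* F) {r : R} (hr : r * 2 = 1) :
    R × F × R × F ≃ R × F × R × F where
  toFun x := (x.1 - x.2.2.1, x.2.1 - x.2.2.2, x.1 + x.2.2.1, x.2.1 + x.2.2.2)
  invFun x := (r * (x.1 + x.2.2.1), π r * (x.2.1 + x.2.2.2),
    r * (x.2.2.1 - x.1), π r * (x.2.2.2 - x.2.1))
  left_inv x := by
    have hr' : π r * 2 = 1 := by rw [← map_ofNat π 2, ← map_mul, hr, map_one]
    ext
    · linear_combination x.1 * hr
    · linear_combination x.2.1 * hr'
    · linear_combination x.2.2.1 * hr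
    · linear_combination x.2.2.2 * hr'
  right_inv x := by
    have hr' : π r * 2 = 1 := by rw [← map_ofNat π 2, ← map_mul, hr, map_one]
    ext
    · linear_combination x.1 * hr
    · linear_combination x.2.1 * hr'
    · linear_combination x.2.2.1 * hr
    · linear_combination x.2.2.2 * hr'

theorem hyperbolicPairing_diagonalToHyperbolic {r : R} (hr : r * 2 = 1) (x y : R × F × R × F) :
    hyperbolicPairing φ (diagonalToHyperbolic π hr x) (diagonalToHyperbolic π hr y) =
      2 * diagonalPairing φ x y := by
  simp only [hyperbolicPairing, diagonalPairing, diagonalToHyperbolic, Equiv.coe_fn_mk]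
  rw [show (x.2.1 - x.2.2.2) * (y.2.1 + y.2.2.2) + (x.2.1 + x.2.2.2) * (y.2.1 - y.2.2.2) =
    x.2.1 * y.2.1 + x.2.1 * y.2.1 - (x.2.2.2 * y.2.2.2 + x.2.2.2 * y.2.2.2) by ring,
    map_sub, map_add, map_add]
  ring

/-- A Lagrangian set for the diagonal pairing is a subgroup. -/
def IsLagrangian.toAddSubgroup {S : Set (R × F × R × F)}
    (hS : IsLagrangian (diagonalPairing φ) S) : AddSubgroup (R × F × R × F) where
  carrier := S
  zero_mem' := (hS _).2 fun w _ => by simp [diagonalPairing]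
  add_mem' {x y} hx hy := (hS _).2 fun w hw => by
    have hx' := (hS _).1 hx w hw
    have hy' := (hS _).1 hy w hw
    simp only [diagonalPairing, Prod.fst_add, Prod.snd_add, add_mul, map_add] at hx' hy' ⊢
    linear_combination hx' + hy'
  neg_mem' {x} hx := (hS _).2 fun w hw => by
    have hx' := (hS _).1 hx w hw
    simp only [diagonalPairing, Prod.fst_neg, Prod.snd_neg, neg_mul, map_neg] at hx' ⊢
    linear_combination -hx'

theorem IsSquareZeroExt.card_addSubgroup_isLagrangian [Finite F] (h : IsSquareZeroExt π φ)
    (h2 : (2 : F) ≠ 0) :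
    Nat.card {L : AddSubgroup (R × F × R × F) // IsLagrangian (diagonalPairing φ) (L : Set _)} =
      4 * Nat.card F + 2 := by
  obtain ⟨r, hr⟩ := h.exists_inv (s := 2) (by rwa [map_ofNat])
  have he (x y : R × F × R × F) : diagonalPairing φ x y = 0 ↔ hyperbolicPairing φ
      (diagonalToHyperbolic π hr x) (diagonalToHyperbolic π hr y) = 0 := by
    rw [hyperbolicPairing_diagonalToHyperbolic]
    exact ⟨fun H => by rw [H, mul_zero], fun H => by
      linear_combination r * H - diagonalPairing φ x y * hr⟩
  rw [← h.card_isLagrangian h2]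
  refine Nat.card_congr
    { toFun := fun L => ⟨(diagonalToHyperbolic π hr).symm ⁻¹' L, L.2.preimage _ fun x y => by
        rw [he]; simp⟩
      invFun := fun S => ⟨(S.2.preimage (diagonalToHyperbolic π hr) he).toAddSubgroup,
        S.2.preimage _ he⟩
      left_inv := fun L => ?_
      right_inv := fun S => ?_ }
  · ext x
    simp [IsLagrangian.toAddSubgroup]
  · ext x
    simp [IsLagrangian.toAddSubgroup]

end Hyperbolic

/-- Multiplication by `p` as a map `ZMod p → ZMod (p ^ 2)`. -/
def zmodMulP (p : ℕ) : ZMod p →+ ZMod (p ^ 2) :=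
  ZMod.lift p ⟨(AddMonoidHom.mulLeft (p : ZMod (p ^ 2))).comp (Int.castAddHom _), by
    simp only [AddMonoidHom.comp_apply, Int.coe_castAddHom, AddMonoidHom.coe_mulLeft,
      Int.cast_natCast]
    rw [← sq]
    exact_mod_cast ZMod.natCast_self (p ^ 2)⟩

theorem zmodMulP_natCast (p n : ℕ) : zmodMulP p n = ((p * n : ℕ) : ZMod (p ^ 2)) := by
  rw [← Int.cast_natCast n, zmodMulP, ZMod.lift_coe]
  simp

theorem zmod_isSquareZeroExt (p : ℕ) [Fact p.Prime] :
    IsSquareZeroExt (ZMod.castHom (dvd_pow_self p two_ne_zero) (ZMod p)) (zmodMulP p) where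
  smul a x := by
    obtain ⟨a, rfl⟩ := ZMod.natCast_zmod_surjective a
    obtain ⟨x, rfl⟩ := ZMod.natCast_zmod_surjective x
    rw [map_natCast (ZMod.castHom _ _), ← Nat.cast_mul, zmodMulP_natCast, zmodMulP_natCast]
    push_cast
    ring
  inj := by
    rw [injective_iff_map_eq_zero]
    intro x hx
    obtain ⟨x, rfl⟩ := ZMod.natCast_zmod_surjective x
    rw [zmodMulP_natCast, ZMod.natCast_eq_zero_iff, sq] at hx
    rw [ZMod.natCast_eq_zero_iff]
    exact Nat.dvd_of_mul_dvd_mul_left (Nat.Prime.pos Fact.out) hx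
  surj := ZMod.ringHom_surjective _
  proj x := by
    obtain ⟨x, rfl⟩ := ZMod.natCast_zmod_surjective x
    rw [zmodMulP_natCast, map_natCast]
    simp
  ker a ha := by
    obtain ⟨a, rfl⟩ := ZMod.natCast_zmod_surjective a
    rw [map_natCast, ZMod.natCast_eq_zero_iff] at ha
    obtain ⟨k, rfl⟩ := ha
    exact ⟨k, (zmodMulP_natCast p k).symm⟩

theorem pairingB_eq_diagonalPairing (p : ℕ) [Fact p.Prime] :
    pairingB p = diagonalPairing (zmodMulP p) := by
  have hval (x y : ZMod p) : zmodMulP p (x * y) = ((p * (x.val * y.val) : ℕ) : ZMod (p ^ 2)) := by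
    rw [← zmodMulP_natCast]
    simp
  ext v w
  rw [pairingB, diagonalPairing, hval, hval]

/-- The number of subgroups `L` of `G = ZMod p² × ZMod p × ZMod p² × ZMod p` with
`L = L^⊥` for the pairing `b` equals `4p + 2` (`p` an odd prime). -/
theorem selfdual_subgroup_count (p : ℕ) (hp : p.Prime) (hodd : Odd p) :
    Nat.card {L : AddSubgroup (ZMod (p ^ 2) × ZMod p × ZMod (p ^ 2) × ZMod p) //
      ∀ v, v ∈ L ↔ ∀ w ∈ L, pairingB p v w = 0} = 4 * p + 2 := by
  have := Fact.mk hp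
  have h2 : (2 : ZMod p) ≠ 0 := by
    refine Ring.two_ne_zero ?_
    rw [ZMod.ringChar_zmod_n]
    rintro rfl
    exact absurd hodd (by decide)
  have hcard := (zmod_isSquareZeroExt p).card_addSubgroup_isLagrangian h2
  rw [Nat.card_zmod, ← pairingB_eq_diagonalPairing] at hcard
  exact hcard
end

section
/- Let p be an odd prime and let n be an integer coprime to p. Then ∑_{a,b,c ∈ ZMod p²} exp( 2πi · n · ((2·a·c + b²).val) / p² ) = p³, where (2·a·c + b²).val denotes the natural-number representative of the element 2·a·c + b² ∈ ZMod p² and the sum is a sum of complex numbers. Equivalently, (1/p³) times the sum equals 1. -/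
open Complex

lemma ZMod.natCast_mul_natCast_sq_eq_zero_iff {p : ℕ} [NeZero p] (m : ℕ) :
    (p : ZMod (p ^ 2)) * (m : ZMod (p ^ 2)) = 0 ↔ p ∣ m := by
  rw [← Nat.cast_mul, ZMod.natCast_eq_zero_iff, sq]
  exact Nat.mul_dvd_mul_iff_left (NeZero.pos p)

/-- The multiples of `p` in `ZMod (p ^ 2)` are the `p` elements annihilated by `p`. -/
lemma ZMod.card_natCast_mul_eq_zero_sq (p : ℕ) [NeZero p] :
    (Finset.univ.filter fun b : ZMod (p ^ 2) => (p : ZMod (p ^ 2)) * b = 0).card = p := by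
  have hpos : 0 < p := NeZero.pos p
  conv_rhs => rw [← Finset.card_range p]
  symm
  refine Finset.card_bij (fun k _ => ((p * k : ℕ) : ZMod (p ^ 2))) ?_ ?_ ?_
  · intro k _
    exact Finset.mem_filter.2 ⟨Finset.mem_univ _,
      (ZMod.natCast_mul_natCast_sq_eq_zero_iff _).2 (Dvd.intro _ rfl)⟩
  · intro k hk l hl h
    rw [Finset.mem_range] at hk hl
    have hlt : ∀ {j}, j < p → p * j < p ^ 2 := fun hj => by
      rw [sq]; exact Nat.mul_lt_mul_of_pos_left hj hpos
    rw [ZMod.natCast_eq_natCast_iff', Nat.mod_eq_of_lt (hlt hk), Nat.mod_eq_of_lt (hlt hl)] at h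
    exact Nat.eq_of_mul_eq_mul_left hpos h
  · intro b hb
    have hb' := (Finset.mem_filter.1 hb).2
    rw [← ZMod.natCast_zmod_val b, ZMod.natCast_mul_natCast_sq_eq_zero_iff] at hb'
    obtain ⟨k, hk⟩ := hb'
    have hlt := ZMod.val_lt b
    rw [hk, sq] at hlt
    exact ⟨k, Finset.mem_range.2 (Nat.lt_of_mul_lt_mul_left hlt),
      by rw [← hk, ZMod.natCast_zmod_val]⟩

lemma ZMod.isUnit_two_of_odd_pow {p : ℕ} (hodd : Odd p) (k : ℕ) :
    IsUnit (2 : ZMod (p ^ k)) := by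
  have h : Nat.Coprime 2 (p ^ k) := (Nat.coprime_two_left.2 hodd).pow_right k
  exact_mod_cast (ZMod.isUnit_iff_coprime 2 (p ^ k)).2 h

/-- The quadratic Gauss sum of a primitive additive character modulo `p ^ 2`, `p` odd. -/
lemma AddChar.IsPrimitive.sum_sq_zmod_sq {p : ℕ} [NeZero p] (hodd : Odd p)
    {ψ : AddChar (ZMod (p ^ 2)) ℂ} (hψ : ψ.IsPrimitive) :
    ∑ b, ψ (b ^ 2) = p := by
  have hp2 : (p : ZMod (p ^ 2)) * p = 0 := by
    have := ZMod.natCast_self (p ^ 2)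
    rwa [Nat.cast_pow, pow_two (p : ZMod (p ^ 2))] at this
  have h2 := ZMod.isUnit_two_of_odd_pow hodd 2
  have hshift : ∀ t : ZMod (p ^ 2),
      ∑ b, ψ (b ^ 2) = ∑ b, ψ (b ^ 2) * ψ (t * (2 * ((p : ZMod (p ^ 2)) * b))) := by
    intro t
    rw [← Equiv.sum_comp (Equiv.addRight ((p : ZMod (p ^ 2)) * t))]
    refine Finset.sum_congr rfl fun b _ => ?_
    rw [← AddChar.map_add_eq_mul, Equiv.coe_addRight]
    congr 1
    linear_combination t ^ 2 * hp2
  have hterm : ∀ b : ZMod (p ^ 2), ψ (b ^ 2) * ∑ t, ψ (t * (2 * ((p : ZMod (p ^ 2)) * b))) =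
      if (p : ZMod (p ^ 2)) * b = 0 then (p : ℂ) ^ 2 else 0 := by
    intro b
    rw [AddChar.sum_mulShift _ hψ]
    simp only [h2.mul_right_eq_zero]
    split_ifs with hb
    · obtain ⟨k, hk⟩ := (ZMod.natCast_mul_natCast_sq_eq_zero_iff b.val).1
        (by rwa [ZMod.natCast_zmod_val])
      have hbk : b = p * k := by
        rw [← ZMod.natCast_zmod_val b, hk, Nat.cast_mul]
      have hsq : b ^ 2 = 0 := by
        rw [hbk]
        linear_combination (k : ZMod (p ^ 2)) ^ 2 * hp2
      simp [hsq, ZMod.card]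
    · simp
  have hsum : (p : ℂ) ^ 2 * ∑ b, ψ (b ^ 2) = (p : ℂ) ^ 2 * p := by
    calc (p : ℂ) ^ 2 * ∑ b, ψ (b ^ 2)
        = ∑ _t : ZMod (p ^ 2), ∑ b, ψ (b ^ 2) := by simp [ZMod.card]
      _ = ∑ t : ZMod (p ^ 2), ∑ b, ψ (b ^ 2) * ψ (t * (2 * ((p : ZMod (p ^ 2)) * b))) :=
          Finset.sum_congr rfl fun t _ => hshift t
      _ = ∑ b : ZMod (p ^ 2), ψ (b ^ 2) * ∑ t, ψ (t * (2 * ((p : ZMod (p ^ 2)) * b))) := by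
          rw [Finset.sum_comm]
          simp_rw [Finset.mul_sum]
      _ = (p : ℂ) ^ 2 * p := by
          simp_rw [hterm]
          rw [← Finset.sum_filter, Finset.sum_const, ZMod.card_natCast_mul_eq_zero_sq,
            nsmul_eq_mul, mul_comm]
  exact mul_left_cancel₀ (pow_ne_zero 2 (Nat.cast_ne_zero.2 (NeZero.ne p))) hsum

/-- The character sum of the hyperbolic form `2ac` over a finite ring in which `2` is a unit. -/
lemma AddChar.IsPrimitive.sum_sum_two_mul {R : Type*} [CommRing R] [Fintype R]
    {ψ : AddChar R ℂ} (hψ : ψ.IsPrimitive) (h2 : IsUnit (2 : R)) :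
    ∑ a, ∑ c, ψ (2 * a * c) = Fintype.card R := by
  classical
  have h : ∀ a : R, ∑ c, ψ (2 * a * c) = if a = 0 then (Fintype.card R : ℂ) else 0 := by
    intro a
    simp_rw [mul_comm (2 * a)]
    rw [AddChar.sum_mulShift _ hψ]
    simp only [h2.mul_right_eq_zero]
    split_ifs <;> simp
  simp [h]

/-- For `p` an odd prime and `n` coprime to `p`, the Gauss-type sum
`∑_{a,b,c ∈ ZMod p²} exp(2πi·n·((2ac + b²).val)/p²)` equals `p³`. -/
theorem gauss_sum_value (p : ℕ) [hp : Fact p.Prime] (hodd : Odd p) (n : ℤ)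
    (hn : IsCoprime n (p : ℤ)) :
    ∑ a : ZMod (p ^ 2), ∑ b : ZMod (p ^ 2), ∑ c : ZMod (p ^ 2),
      Complex.exp (2 * Real.pi * Complex.I * (n : ℂ) *
        ((2 * a * c + b ^ 2).val : ℂ) / ((p : ℂ) ^ 2)) = (p : ℂ) ^ 3 := by
  have : NeZero p := ⟨hp.out.ne_zero⟩
  have hunit : IsUnit (n : ZMod (p ^ 2)) := by
    have h : IsCoprime n ((p ^ 2 : ℕ) : ℤ) := by
      rw [Nat.cast_pow]
      exact hn.pow_right
    simpa using (ZMod.coe_int_isUnit_iff_isCoprime n (p ^ 2)).2 h.symm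
  let ψ : AddChar (ZMod (p ^ 2)) ℂ := ZMod.stdAddChar.mulShift (n : ZMod (p ^ 2))
  have hψ : ψ.IsPrimitive := by
    intro a ha
    rw [AddChar.mulShift_mulShift]
    exact ZMod.isPrimitive_stdAddChar _ (mt hunit.mul_right_eq_zero.1 ha)
  have hexp : ∀ x : ZMod (p ^ 2),
      Complex.exp (2 * Real.pi * Complex.I * (n : ℂ) * (x.val : ℂ) / ((p : ℂ) ^ 2)) = ψ x := by
    intro x
    have hx : (n : ZMod (p ^ 2)) * x = ((n * x.val : ℤ) : ZMod (p ^ 2)) := by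
      simp
    rw [AddChar.mulShift_apply, hx, ZMod.stdAddChar_coe]
    push_cast
    congr 1
    ring
  simp_rw [hexp, AddChar.map_add_eq_mul, ← Finset.sum_mul]
  simp_rw [← Finset.mul_sum, ← Finset.sum_mul]
  rw [hψ.sum_sum_two_mul (ZMod.isUnit_two_of_odd_pow hodd 2), hψ.sum_sq_zmod_sq hodd, ZMod.card]
  push_cast
  ring
end
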